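/- Fix D ≥ 1 and let λ_col = {(i, 0) : 0 ≤ i < D} be the column of D boxes (a nonempty connected skew diagram). Then in ℤ⟦q⟧ one has (1 − q^D) · FZ_{λ_col}(q) = Z(q); that is, the generating series counting pairs (μ, ν) of Young diagrams with |μ| = n, μ ⊆ ν and ν ∖ μ a translate of a single column of D boxes equals Z(q)/(1 − q^D). -/

import Mathlib

open PowerSeries

/-- The number of Young diagrams (partitions) of size `n`. -/
noncomputable def partitionCount (n : ℕ) : ℕ :=
  Nat.card {μ : YoungDiagram // μ.card = n}

/-- `Z(q)`, the generating series of partition numbers. -/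
noncomputable def Zq : PowerSeries ℤ :=
  PowerSeries.mk fun n => (partitionCount n : ℤ)

/-- The number of pairs `(μ, ν)` of Young diagrams with `μ ⊆ ν`, `|μ| = n`, `|ν| = n + D`. -/
noncomputable def nestedPairCount (D n : ℕ) : ℕ :=
  Nat.card {p : YoungDiagram × YoungDiagram //
    p.1 ≤ p.2 ∧ p.1.card = n ∧ p.2.card = n + D}

/-- `FZ_D(q)`, the generating series of `nestedPairCount D`. -/
noncomputable def FZ (D : ℕ) : PowerSeries ℤ :=
  PowerSeries.mk fun n => (nestedPairCount D n : ℤ)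

/-- Two boxes of `ℕ × ℕ` are adjacent if they differ by `(1,0)` or `(0,1)`. -/
def Adjacent (a b : ℕ × ℕ) : Prop :=
  (a.1 = b.1 ∧ (a.2 + 1 = b.2 ∨ b.2 + 1 = a.2)) ∨
  (a.2 = b.2 ∧ (a.1 + 1 = b.1 ∨ b.1 + 1 = a.1))

/-- A finite set of boxes is connected if the graph on its boxes, with edges between
adjacent boxes, is connected. -/
def ConnectedBoxes (l : Finset (ℕ × ℕ)) : Prop :=
  ∀ a ∈ l, ∀ b ∈ l,
    Relation.ReflTransGen (fun x y => x ∈ l ∧ y ∈ l ∧ Adjacent x y) a b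

/-- A skew diagram is the set difference of two nested Young diagrams. -/
def IsSkewDiagram (l : Finset (ℕ × ℕ)) : Prop :=
  ∃ α β : YoungDiagram, α ≤ β ∧ l = β.cells \ α.cells

def boxToZ (b : ℕ × ℕ) : ℤ × ℤ := ((b.1 : ℤ), (b.2 : ℤ))

/-- `m` is a translate of `l` (inside `ℤ × ℤ`). -/
def IsTranslateOf (m l : Finset (ℕ × ℕ)) : Prop :=
  ∃ t : ℤ × ℤ, m.image boxToZ = l.image fun b => boxToZ b + t

/-- `A_n(λ)`: the number of pairs `(μ, ν)` of Young diagrams with `μ ⊆ ν`, `|μ| = n`,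
and `ν ∖ μ` a translate of `l`. -/
noncomputable def skewPairCount (l : Finset (ℕ × ℕ)) (n : ℕ) : ℕ :=
  Nat.card {p : YoungDiagram × YoungDiagram //
    p.1 ≤ p.2 ∧ p.1.card = n ∧ IsTranslateOf (p.2.cells \ p.1.cells) l}

/-- `FZ_λ(q)`, the generating series of `skewPairCount l`. -/
noncomputable def FZskew (l : Finset (ℕ × ℕ)) : PowerSeries ℤ :=
  PowerSeries.mk fun n => (skewPairCount l n : ℤ)

namespace YoungDiagram

/-- `ν` is obtained from `μ` by adding `D` boxes to the column with index `k`. -/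
def ColumnAdded (D k : ℕ) (μ ν : YoungDiagram) : Prop :=
  ∀ j, ν.colLen j = μ.colLen j + if j = k then D else 0

theorem le_iff_colLen_le {μ ν : YoungDiagram} : μ ≤ ν ↔ ∀ j, μ.colLen j ≤ ν.colLen j := by
  constructor
  · intro h j
    by_contra! hlt
    exact lt_irrefl _ (mem_iff_lt_colLen.1 (h (mem_iff_lt_colLen.2 hlt)))
  · rintro h ⟨i, j⟩ hc
    exact mem_iff_lt_colLen.2 ((mem_iff_lt_colLen.1 hc).trans_le (h j))

theorem ext_colLen {μ ν : YoungDiagram} (h : ∀ j, μ.colLen j = ν.colLen j) : μ = ν :=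
  le_antisymm (le_iff_colLen_le.2 fun j => (h j).le) (le_iff_colLen_le.2 fun j => (h j).ge)

theorem colLen_le_card (μ : YoungDiagram) (j : ℕ) : μ.colLen j ≤ μ.card := by
  rw [colLen_eq_card]
  exact Finset.card_le_card (Finset.filter_subset _ _)

theorem rowLen_le_card (μ : YoungDiagram) (i : ℕ) : μ.rowLen i ≤ μ.card := by
  rw [rowLen_eq_card]
  exact Finset.card_le_card (Finset.filter_subset _ _)

theorem colLen_eq_zero (μ : YoungDiagram) {j : ℕ} (hj : μ.rowLen 0 ≤ j) : μ.colLen j = 0 := by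
  by_contra h
  have := mem_iff_lt_rowLen.1 (mem_iff_lt_colLen.2 (Nat.pos_of_ne_zero h))
  omega

/-- An antitone, eventually zero sequence is the sequence of column lengths of a diagram. -/
theorem exists_colLen_eq {f : ℕ → ℕ} (hf : Antitone f) {N : ℕ} (hN : ∀ j, N ≤ j → f j = 0) :
    ∃ μ : YoungDiagram, ∀ j, μ.colLen j = f j := by
  let μ : YoungDiagram :=
    { cells := (Finset.range (f 0) ×ˢ Finset.range N).filter fun c => c.1 < f c.2
      isLowerSet := by
        rintro ⟨i, j⟩ ⟨i', j'⟩ ⟨hi, hj⟩ h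
        simp only [Finset.coe_filter, Finset.mem_product, Finset.mem_range,
          Set.mem_ofPred_eq] at h hi hj ⊢
        have := hf hj
        omega }
  have hμ : ∀ i j, (i, j) ∈ μ ↔ i < f j := by
    intro i j
    rw [← mem_cells]
    simp only [μ, Finset.mem_filter, Finset.mem_product, Finset.mem_range]
    refine ⟨fun h => h.2, fun h => ⟨⟨h.trans_le (hf (Nat.zero_le j)), ?_⟩, h⟩⟩
    by_contra! hj
    have := hN j hj
    omega
  refine ⟨μ, fun j => ?_⟩
  have h₁ := hμ (f j) j
  have h₂ := hμ (μ.colLen j) j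
  rw [mem_iff_lt_colLen] at h₁ h₂
  omega

theorem finite_card_eq (n : ℕ) : {μ : YoungDiagram | μ.card = n}.Finite := by
  refine Set.Finite.of_finite_image (f := cells)
    ((Finset.finite_toSet (Finset.range n ×ˢ Finset.range n).powerset).subset ?_)
    (fun μ _ ν _ h => YoungDiagram.ext h)
  rintro _ ⟨μ, rfl, rfl⟩
  simp only [Finset.coe_powerset, Set.mem_preimage, Set.mem_powerset_iff, Finset.coe_subset]
  rintro ⟨i, j⟩ hc
  rw [mem_cells] at hc
  exact Finset.mem_product.2
    ⟨Finset.mem_range.2 ((mem_iff_lt_colLen.1 hc).trans_le (μ.colLen_le_card j)),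
      Finset.mem_range.2 ((mem_iff_lt_rowLen.1 hc).trans_le (μ.rowLen_le_card i))⟩

theorem isTranslateOf_column_iff {D : ℕ} (hD : 1 ≤ D) (m : Finset (ℕ × ℕ)) :
    IsTranslateOf m ((Finset.range D).image fun i => (i, 0)) ↔
      ∃ a k : ℕ, ∀ i j, (i, j) ∈ m ↔ j = k ∧ a ≤ i ∧ i < a + D := by
  simp only [IsTranslateOf, Finset.ext_iff, Finset.mem_image, Finset.mem_range, boxToZ,
    Prod.exists, Prod.forall, Prod.mk.injEq, Prod.mk_add_mk]
  constructor
  · rintro ⟨x, y, h⟩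
    obtain ⟨a, k, -, ha, hk⟩ := (h x y).2 ⟨0, 0, ⟨0, hD, rfl, rfl⟩, by simp, by simp⟩
    refine ⟨a, k, fun i j => ?_⟩
    constructor
    · intro hm
      obtain ⟨i', j', ⟨e, he, rfl, rfl⟩, h₁, h₂⟩ := (h i j).1 ⟨i, j, hm, rfl, rfl⟩
      omega
    · rintro ⟨rfl, h₁, h₂⟩
      obtain ⟨i', j', hm, h₃, h₄⟩ :=
        (h i j).2 ⟨i - a, 0, ⟨i - a, by omega, rfl, rfl⟩, by omega, by omega⟩
      obtain rfl : i' = i := by omega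
      obtain rfl : j' = j := by omega
      exact hm
  · rintro ⟨a, k, h⟩
    refine ⟨a, k, fun x y => ?_⟩
    constructor
    · rintro ⟨i, j, hm, rfl, rfl⟩
      obtain ⟨rfl, h₁, h₂⟩ := (h i j).1 hm
      exact ⟨i - a, 0, ⟨i - a, by omega, rfl, rfl⟩, by omega, by omega⟩
    · rintro ⟨_, _, ⟨e, he, rfl, rfl⟩, rfl, rfl⟩
      exact ⟨e + a, k, (h _ _).2 ⟨rfl, by omega, by omega⟩, by omega, by omega⟩

theorem le_and_isTranslateOf_column_iff {D : ℕ} (hD : 1 ≤ D) (μ ν : YoungDiagram) :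
    (μ ≤ ν ∧ IsTranslateOf (ν.cells \ μ.cells) ((Finset.range D).image fun i => (i, 0))) ↔
      ∃ k, ColumnAdded D k μ ν := by
  simp only [isTranslateOf_column_iff hD, le_iff_colLen_le, Finset.mem_sdiff, mem_cells,
    mem_iff_lt_colLen]
  constructor
  · rintro ⟨hle, a, k, h⟩
    refine ⟨k, fun j => ?_⟩
    have hj := hle j
    split_ifs with hjk
    · have h₁ := h a j
      have h₂ := h (a + D - 1) j
      have h₃ := h (μ.colLen j) j
      have h₄ := h (ν.colLen j - 1) j
      omega
    · have h₃ := h (μ.colLen j) j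
      omega
  · rintro ⟨k, h⟩
    refine ⟨fun j => by rw [h j]; omega, μ.colLen k, k, fun i j => ?_⟩
    rw [h j]
    split_ifs with hjk
    · subst hjk
      omega
    · omega

namespace ColumnAdded

variable {D k l : ℕ} {μ ν ρ : YoungDiagram}

theorem card_eq (h : ColumnAdded D k μ ν) : ν.card = μ.card + D := by
  have hle : μ ≤ ν := le_iff_colLen_le.2 fun j => by rw [h j]; omega
  have hsdiff : ν.cells \ μ.cells =
      Finset.Ico (μ.colLen k) (μ.colLen k + D) ×ˢ {k} := by
    ext ⟨i, j⟩
    simp only [Finset.mem_sdiff, mem_cells, mem_iff_lt_colLen, h j, Finset.mem_product,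
      Finset.mem_Ico, Finset.mem_singleton]
    split_ifs with hjk
    · subst hjk
      omega
    · omega
  have := Finset.card_sdiff_add_card_eq_card (cells_subset_iff.2 hle)
  rw [hsdiff, Finset.card_product, Nat.card_Ico, Finset.card_singleton] at this
  change ν.cells.card = μ.cells.card + D
  omega

theorem index_unique (hD : 1 ≤ D) (h : ColumnAdded D k μ ν) (h' : ColumnAdded D l μ ν) :
    k = l := by
  by_contra hkl
  have h₁ := h k
  have h₂ := h' k
  rw [if_pos rfl] at h₁
  rw [if_neg hkl] at h₂
  omega

theorem right_unique (h : ColumnAdded D k μ ν) (h' : ColumnAdded D k μ ρ) : ν = ρ :=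
  ext_colLen fun j => by rw [h j, h' j]

theorem left_unique (h : ColumnAdded D k μ ρ) (h' : ColumnAdded D k ν ρ) : μ = ν :=
  ext_colLen fun j => Nat.add_right_cancel ((h j).symm.trans (h' j))

end ColumnAdded

theorem exists_columnAdded {D k : ℕ} {μ : YoungDiagram}
    (h : ∀ j < k, μ.colLen k + D ≤ μ.colLen j) : ∃ ν, ColumnAdded D k μ ν := by
  refine exists_colLen_eq (N := μ.rowLen 0 + k + 1) (fun i j hij => ?_) fun j hj => ?_
  · have hμ := μ.colLen_anti i j hij
    by_cases hj : j = k
    · subst hj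
      rcases hij.lt_or_eq with hlt | rfl
      · have := h i hlt
        split_ifs <;> omega
      · rfl
    · split_ifs <;> omega
  · rw [μ.colLen_eq_zero (by omega), if_neg (by omega)]

theorem ColumnAdded.exists_succ {D k : ℕ} {μ ν : YoungDiagram} (h : ColumnAdded D k μ ν) :
    ∃ ρ, ColumnAdded D (k + 1) ν ρ := by
  refine exists_columnAdded fun j hj => ?_
  have h₁ := ν.colLen_anti j k (by omega)
  have h₂ := μ.colLen_anti k (k + 1) (by omega)
  have h₃ := h k
  have h₄ := h (k + 1)
  rw [if_pos rfl] at h₃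
  rw [if_neg (by omega)] at h₄
  omega

theorem ColumnAdded.exists_pred {D k : ℕ} {ν ρ : YoungDiagram}
    (h : ColumnAdded D (k + 1) ν ρ) : ∃ μ, ColumnAdded D k μ ν := by
  have hk : ν.colLen (k + 1) + D ≤ ν.colLen k := by
    have h₁ := ρ.colLen_anti k (k + 1) (by omega)
    rw [h k, h (k + 1), if_pos rfl, if_neg (by omega)] at h₁
    omega
  have hf : Antitone fun j => ν.colLen j - if j = k then D else 0 := by
    intro i j hij
    have hν := ν.colLen_anti i j hij
    dsimp only
    by_cases hi : i = k
    · subst hi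
      rcases hij.lt_or_eq with hlt | rfl
      · have := ν.colLen_anti (i + 1) j hlt
        split_ifs <;> omega
      · rfl
    · split_ifs <;> omega
  obtain ⟨μ, hμ⟩ := exists_colLen_eq hf (N := ν.rowLen 0) fun j hj => by
    simp [ν.colLen_eq_zero hj]
  refine ⟨μ, fun j => ?_⟩
  rw [hμ j]
  split_ifs with hj
  · subst hj
    omega
  · omega

/-- Pairs `(μ, ν)` with `|μ| = n` where `ν` arises from `μ` by adding `D` boxes to a column. -/
def columnPairs (D n : ℕ) : Set (YoungDiagram × YoungDiagram) :=
  {p | p.1.card = n ∧ ∃ k, ColumnAdded D k p.1 p.2}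

theorem finite_columnPairs (D n : ℕ) : (columnPairs D n).Finite := by
  refine ((finite_card_eq n).prod (finite_card_eq (n + D))).subset ?_
  rintro ⟨μ, ν⟩ ⟨rfl, k, h⟩
  exact ⟨rfl, h.card_eq⟩

theorem skewPairCount_column {D : ℕ} (hD : 1 ≤ D) (n : ℕ) :
    skewPairCount ((Finset.range D).image fun i => (i, 0)) n = (columnPairs D n).ncard := by
  rw [← Nat.card_coe_set_eq]
  refine Nat.card_congr (Equiv.subtypeEquivRight fun p => ?_)
  rw [and_left_comm, le_and_isTranslateOf_column_iff hD]
  rfl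

theorem ncard_columnAdded_zero (D n : ℕ) :
    {p : YoungDiagram × YoungDiagram | p.1.card = n ∧ ColumnAdded D 0 p.1 p.2}.ncard =
      partitionCount n := by
  change _ = Nat.card {μ : YoungDiagram | μ.card = n}
  rw [Nat.card_coe_set_eq, ← Set.InjOn.ncard_image (f := Prod.fst)]
  · congr 1
    ext μ
    constructor
    · rintro ⟨p, ⟨hp, -⟩, rfl⟩
      exact hp
    · intro hμ
      obtain ⟨ν, hν⟩ := exists_columnAdded (D := D) (k := 0) (μ := μ) (by simp)
      exact ⟨(μ, ν), ⟨hμ, hν⟩, rfl⟩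
  · rintro ⟨μ, ν⟩ ⟨-, h⟩ ⟨μ', ν'⟩ ⟨-, h'⟩ (rfl : μ = μ')
    exact congrArg (Prod.mk μ) (h.right_unique h')

theorem ncard_columnAdded_succ {D : ℕ} (hD : 1 ≤ D) (n : ℕ) :
    {p : YoungDiagram × YoungDiagram |
      p.1.card = n + D ∧ ∃ k, ColumnAdded D (k + 1) p.1 p.2}.ncard =
      (columnPairs D n).ncard := by
  let U : Set (YoungDiagram × YoungDiagram × YoungDiagram) :=
    {t | t.1.card = n ∧ ∃ k, ColumnAdded D k t.1 t.2.1 ∧ ColumnAdded D (k + 1) t.2.1 t.2.2}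
  have hfst : (fun t : YoungDiagram × YoungDiagram × YoungDiagram => (t.1, t.2.1)) '' U =
      columnPairs D n := by
    ext ⟨μ, ν⟩
    constructor
    · rintro ⟨⟨_, _, ρ⟩, ⟨hc, k, h, -⟩, ⟨⟩⟩
      exact ⟨hc, k, h⟩
    · rintro ⟨hc, k, h⟩
      obtain ⟨ρ, hρ⟩ := h.exists_succ
      exact ⟨(μ, ν, ρ), ⟨hc, k, h, hρ⟩, rfl⟩
  have hsnd : Prod.snd '' U = {p : YoungDiagram × YoungDiagram |
      p.1.card = n + D ∧ ∃ k, ColumnAdded D (k + 1) p.1 p.2} := by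
    ext ⟨ν, ρ⟩
    constructor
    · rintro ⟨⟨μ, _, _⟩, ⟨hc, k, h, h'⟩, ⟨⟩⟩
      exact ⟨by rw [← hc]; exact h.card_eq, k, h'⟩
    · rintro ⟨hc, k, h⟩
      obtain ⟨μ, hμ⟩ := h.exists_pred
      exact ⟨(μ, ν, ρ), ⟨Nat.add_right_cancel (hμ.card_eq.symm.trans hc), k, hμ, h⟩, rfl⟩
  rw [← hfst, ← hsnd, Set.InjOn.ncard_image, Set.InjOn.ncard_image]
  · rintro ⟨μ, ν, ρ⟩ ⟨-, k, h₁, h₂⟩ ⟨μ', ν', ρ'⟩ ⟨-, l, h₃, h₄⟩ heq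
    simp only [Prod.mk.injEq] at heq
    obtain ⟨rfl, rfl⟩ := heq
    obtain rfl := h₁.index_unique hD h₃
    exact congrArg (fun x => (μ, ν, x)) (h₂.right_unique h₄)
  · rintro ⟨μ, ν, ρ⟩ ⟨-, k, h₁, h₂⟩ ⟨μ', ν', ρ'⟩ ⟨-, l, h₃, h₄⟩ heq
    simp only [Prod.mk.injEq] at heq
    obtain ⟨rfl, rfl⟩ := heq
    obtain rfl := Nat.succ_injective (h₂.index_unique hD h₄)
    exact congrArg (fun x => (x, ν, ρ)) (h₁.left_unique h₃)

theorem ncard_columnPairs {D : ℕ} (hD : 1 ≤ D) (n : ℕ) :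
    (columnPairs D n).ncard =
      partitionCount n + if D ≤ n then (columnPairs D (n - D)).ncard else 0 := by
  have hunion : columnPairs D n =
      {p | p.1.card = n ∧ ColumnAdded D 0 p.1 p.2} ∪
      {p | p.1.card = n ∧ ∃ k, ColumnAdded D (k + 1) p.1 p.2} := by
    ext p
    simp only [columnPairs, Set.mem_ofPred_eq, Set.mem_union, ← and_or_left]
    rw [← Nat.or_exists_add_one]
  have hfin := finite_columnPairs D n
  rw [hunion] at hfin ⊢
  rw [Set.ncard_union_eq ?_ (hfin.subset Set.subset_union_left)
    (hfin.subset Set.subset_union_right), ncard_columnAdded_zero]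
  · congr 1
    split_ifs with hn
    · rw [← ncard_columnAdded_succ hD, Nat.sub_add_cancel hn]
    · rw [Set.ncard_eq_zero (hfin.subset Set.subset_union_right), Set.eq_empty_iff_forall_notMem]
      rintro p ⟨hc, k, h⟩
      obtain ⟨μ, hμ⟩ := h.exists_pred
      have := hμ.card_eq
      omega
  · rw [Set.disjoint_left]
    rintro p ⟨-, h⟩ ⟨-, k, h'⟩
    exact absurd (h.index_unique hD h') (by omega)

end YoungDiagram

/-- for `D ≥ 1` and `λ_col = {(i,0) : 0 ≤ i < D}` the column of `D` boxes,
one has `(1 − q^D)·FZ_{λ_col}(q) = Z(q)` in `ℤ⟦q⟧`. -/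
theorem stmt_6 (D : ℕ) (hD : 1 ≤ D) :
    (1 - PowerSeries.X ^ D) * FZskew ((Finset.range D).image fun i => (i, 0)) = Zq := by
  ext n
  rw [sub_mul, one_mul, map_sub, PowerSeries.coeff_X_pow_mul']
  simp only [FZskew, Zq, PowerSeries.coeff_mk, YoungDiagram.skewPairCount_column hD]
  rw [YoungDiagram.ncard_columnPairs hD n]
  split_ifs <;> simp
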